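/- arXiv:1311.5277 — 2 statements merged into one kernel-verified Lean document; each statement's English description precedes it below -/
import Mathlib

section
/- For every real α ≥ 1, the moments m_n = ∫ xⁿ dμ_α(x) satisfy m_0 = 1 and, for all n ≥ 1, the recurrence m_n = (α − 1)·m_{n−1} + Σ_{k=0}^{n−1} m_k · m_{n−1−k}. -/
open MeasureTheory

noncomputable section

/-- The free Poisson density with parameter `α`:
`f_α(x) = √(4x − (x − (α−1))²) / (2πx)` on `[(√α − 1)², (√α + 1)²]` and `0` elsewhere. -/
def freePoissonDensity (α : ℝ) : ℝ → ℝ :=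
  (Set.Icc ((Real.sqrt α - 1) ^ 2) ((Real.sqrt α + 1) ^ 2)).indicator
    fun x => Real.sqrt (4 * x - (x - (α - 1)) ^ 2) / (2 * Real.pi * x)

/-- The free Poisson law `μ_α`: the measure on `ℝ` absolutely continuous with respect
to Lebesgue measure with density `f_α`. -/
def freePoissonLaw (α : ℝ) : Measure ℝ :=
  volume.withDensity fun x => ENNReal.ofReal (freePoissonDensity α x)

/-- The `n`-th moment of `μ_α`. -/
def freePoissonMoment (α : ℝ) (n : ℕ) : ℝ := ∫ x, x ^ n ∂(freePoissonLaw α)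
open PowerSeries in
theorem ps_aux (β γ : ℝ) (hβ : β ^ 2 - γ ^ 2 = 4 * (γ + 1)) (hβ2 : β = γ + 2) (m : ℕ → ℝ) (h0 : m 0 = 1) (h1 : m 1 = γ + 1)
    (hr : ∀ k : ℕ, (k + 3) * m (k + 2) = (2 * k + 3) * β * m (k + 1) - k * γ ^ 2 * m k) (n : ℕ) :
    m (n + 1) = γ * m n + ∑ k ∈ Finset.range (n + 1), m k * m (n - k) := by
  set M : PowerSeries ℝ := PowerSeries.mk m with hM
  set Q : PowerSeries ℝ := 1 - C (2 * β) * X + C (γ ^ 2) * X * X with hQ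
  set S : PowerSeries ℝ := C 2 * M * X + C γ * X - 1 with hS
  have hQ' : derivative ℝ Q = - C (2 * β) + C (2 * γ ^ 2) * X := by
    rw [hQ]
    simp only [map_add, map_sub, Derivation.leibniz, derivative_C, derivative_X, smul_eq_mul,
      Derivation.map_one_eq_zero, map_mul]
    have h2 : (C (2:ℝ) : PowerSeries ℝ) = 2 := map_ofNat C 2
    simp [h2]
    ring
  have hS' : derivative ℝ S = C 2 * derivative ℝ M * X + C 2 * M + C γ := by
    rw [hS]
    simp only [map_add, map_sub, Derivation.leibniz, derivative_C, derivative_X, smul_eq_mul,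
      Derivation.map_one_eq_zero, map_mul]
    ring
  have key : C 2 * Q * derivative ℝ S = derivative ℝ Q * S := by
    have e1 : C 2 * Q * derivative ℝ S = 
      C 4 * (derivative ℝ M * X + M - C (2*β) * (derivative ℝ M * X * X + M * X) + C (γ^2) * (derivative ℝ M * X * X * X + M * X * X))
       + C (2 * γ) * (1 - C (2*β) * X + C (γ^2) * X * X) := by
      rw [hS', hQ, show (C (4:ℝ) : PowerSeries ℝ) = C 2 * C 2 by rw [← map_mul]; norm_num, map_mul C 2 γ]
      ring
    have e2 : derivative ℝ Q * S = - C (4 * β) * (M * X) + C (4 * γ^2) * (M * X * X) - C (2 * β * γ) * X + C (2 * γ^3) * X * X + C (2*β) - C (2 * γ^2) * X := by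
      rw [hQ', hS, show (4:ℝ) * β = 2 * (2 * β) by ring, show (4:ℝ) * γ ^ 2 = 2 * (2 * γ^2) by ring, show 2 * γ ^ 3 = (2 * γ ^ 2) * γ by ring,
        map_mul C 2 (2 * β), map_mul C 2 (2 * γ ^ 2), map_mul C (2 * β) γ, map_mul C (2 * γ^2) γ]
      ring
    rw [e1, e2]
    ext j
    match j with
    | 0 => 
      simp [mul_assoc, hM, h0]
      linarith
    | 1 => 
      simp only [map_add, map_sub, map_neg, neg_mul, mul_assoc, coeff_C_mul]
      simp only [← mul_assoc, show ∀ f : PowerSeries ℝ, coeff 1 (f * X) = coeff 0 f from fun f => coeff_succ_mul_X 0 f]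
      simp [hM, coeff_derivative, h0, h1, coeff_one, coeff_C, coeff_X]
      subst hβ2
      ring
    | 2 => 
      have := hr 0
      simp only [map_add, map_sub, map_neg, neg_mul, mul_assoc, coeff_C_mul]
      simp only [← mul_assoc, show (2:ℕ) = 0 + 1 + 1 from rfl, coeff_succ_mul_X]
      simp [hM, coeff_derivative, h0, h1, coeff_one, coeff_C, coeff_X] at this ⊢
      subst hβ2
      linear_combination 4 * this
    | k + 3 => 
      have := hr (k + 1)
      simp only [map_add, map_sub, map_neg, neg_mul, mul_assoc, coeff_C_mul]
      simp only [← mul_assoc, show k + 3 = k + 1 + 1 + 1 from rfl, coeff_succ_mul_X]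
      simp [hM, coeff_derivative, h0, h1, coeff_one, coeff_C, coeff_X] at this ⊢
      linear_combination 4 * this
  have hQ0 : constantCoeff Q ≠ 0 := by simp [hQ]
  have hSQ : S * S = Q := by
    have : S * S * Q⁻¹ = 1 := by
      apply derivative.ext
      · have hi : Q * Q⁻¹ = 1 := PowerSeries.mul_inv_cancel _ hQ0
        simp only [Derivation.leibniz, smul_eq_mul, derivative_inv', Derivation.map_one_eq_zero]
        have h2 : (C (2:ℝ) : PowerSeries ℝ) = 2 := map_ofNat C 2
        rw [h2] at key
        linear_combination (S * Q⁻¹ ^2) * key - 2 * S * derivative ℝ S * Q⁻¹ * hi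
      · simp [hS, hQ]
    have hi : Q⁻¹ * Q = 1 := PowerSeries.inv_mul_cancel _ hQ0
    linear_combination Q * this - S * S * hi
  have hR : X * M * M + (C γ * X - 1) * M + 1 = 0 := by
    have : C 4 * X * (X * M * M + (C γ * X - 1) * M + 1) = 0 := by
      have e4 : (C (4:ℝ) : PowerSeries ℝ) = 4 := map_ofNat C 4
      have e2 : (C (2:ℝ) : PowerSeries ℝ) = 2 := map_ofNat C 2
      have hb : C (2 * β) = 2 * C γ + 4 := by rw [hβ2, ← e4, ← e2, ← map_mul, ← map_add]; congr 1; ring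
      rw [hS, hQ, e2, hb, map_pow] at hSQ
      rw [e4]
      linear_combination hSQ
    have h4 : (C (4:ℝ) : PowerSeries ℝ) ≠ 0 := by simp
    simpa [h4, X_ne_zero] using this
  have := congrArg (coeff (n + 1)) hR
  have e : X * M * M + (C γ * X - 1) * M + 1 = (M * M) * X + C γ * (M * X) - M + 1 := by ring
  rw [e] at this
  simp only [map_add, map_sub, coeff_C_mul, coeff_succ_mul_X, coeff_one] at this
  rw [coeff_mul, Finset.Nat.sum_antidiagonal_eq_sum_range_succ_mk] at this
  simp [hM] at this
  linarith

open Real in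
/-- basic fundamental-theorem setup -/
theorem ibp_aux (β γ a b : ℝ) (ha : 0 ≤ a) (hab : a < b) (hs : a + b = 2 * β) (hp : a * b = γ ^ 2) (k : ℕ) :
    (k + 3) * (∫ x in a..b, √((b - x) * (x - a)) * x ^ (k + 1)) =
      (2 * k + 3) * β * (∫ x in a..b, √((b - x) * (x - a)) * x ^ k) 
        - k * γ ^ 2 * (∫ x in a..b, √((b - x) * (x - a)) * x ^ (k - 1)) := by
  have hI : ∀ j : ℕ, IntervalIntegrable (fun x => √((b - x) * (x - a)) * x ^ j) volume a b := fun j => by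
    apply Continuous.intervalIntegrable; fun_prop
  have h := intervalIntegral.integral_eq_sub_of_hasDerivAt_of_le (a := a) (b := b)
    (f := fun x => √((b - x) * (x - a)) * ((b - x) * (x - a)) * x ^ k)
    (f' := fun x => (2 * k + 3) * β * (√((b - x) * (x - a)) * x ^ k) 
        - k * γ ^ 2 * (√((b - x) * (x - a)) * x ^ (k - 1)) - (k + 3) * (√((b - x) * (x - a)) * x ^ (k + 1))) hab.le
    (by fun_prop) ?_ ((((hI _).const_mul _).sub ((hI _).const_mul _)).sub ((hI _).const_mul _))
  · rw [intervalIntegral.integral_sub (((hI _).const_mul _).sub ((hI _).const_mul _)) ((hI _).const_mul _),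
      intervalIntegral.integral_sub ((hI _).const_mul _) ((hI _).const_mul _)] at h
    simp only [intervalIntegral.integral_const_mul] at h
    simp at h
    linarith
  · intro x hx
    have hw : 0 < (b - x) * (x - a) := mul_pos (by linarith [hx.2]) (by linarith [hx.1])
    have h1 : HasDerivAt (fun x => (b - x) * (x - a)) (2 * (β - x)) x := by
      refine HasDerivAt.congr_deriv (((hasDerivAt_id x).const_sub b).mul ((hasDerivAt_id x).sub_const a)) (Eq.symm ?_)
      simp; linarith
    have h2 := ((h1.sqrt hw.ne').mul h1).mul (hasDerivAt_pow k x)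
    refine HasDerivAt.congr_deriv h2 (Eq.symm ?_)
    have hq := Real.sq_sqrt hw.le
    have hq0 := Real.sqrt_pos.2 hw
    have hw2 : (b - x) * (x - a) = 2 * β * x - x ^ 2 - γ ^ 2 := by rw [← hs, ← hp]; ring
    simp only [Pi.mul_apply]
    set q := √((b - x) * (x - a)) with hqd
    rw [← hq]
    rw [hw2] at hq
    field_simp
    rcases k with _ | k
    · simp; ring
    · simp only [Nat.add_sub_cancel]; push_cast
      rw [show q ^ 2 = 2 * β * x - x ^ 2 - γ ^ 2 from hq]
      ring

open Real in
theorem m1_aux (β r a b : ℝ) (hr : 0 < r) (ha : a = β - r) (hb : b = β + r) :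
    (∫ x in a..b, √((b - x) * (x - a)))  = π * r ^ 2 / 2 := by
  have hab : a < b := by linarith
  have h := intervalIntegral.integral_eq_sub_of_hasDerivAt_of_le (a := a) (b := b)
    (f := fun x => ((x - β) * √((b - x) * (x - a)) + r ^ 2 * arcsin ((x - β) / r)) / 2)
    (f' := fun x => √((b - x) * (x - a))) hab.le
    (by have := continuous_arcsin; fun_prop) ?_ (by apply Continuous.intervalIntegrable; fun_prop)
  · rw [h]
    have e1 : (b - β) / r = 1 := by rw [hb]; field_simp; ring
    have e2 : (a - β) / r = -1 := by rw [ha]; field_simp; ring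
    simp only [e1, e2]
    simp
    ring
  · intro x hx
    have hw : 0 < (b - x) * (x - a) := mul_pos (by linarith [hx.2]) (by linarith [hx.1])
    have h1 : HasDerivAt (fun x => (b - x) * (x - a)) (2 * (β - x)) x := by
      refine HasDerivAt.congr_deriv (((hasDerivAt_id x).const_sub b).mul ((hasDerivAt_id x).sub_const a)) (Eq.symm ?_)
      simp; linarith
    have hx1 : (x - β) / r < 1 := by rw [div_lt_one hr]; linarith [hx.2]
    have hx2 : -1 < (x - β) / r := by rw [lt_div_iff₀ hr]; linarith [hx.1]
    have h3 := (hasDerivAt_arcsin hx2.ne' hx1.ne).comp x (((hasDerivAt_id x).sub_const β).div_const r)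
    have h2 := ((((hasDerivAt_id x).sub_const β).mul (h1.sqrt hw.ne')).add (h3.const_mul (r ^ 2))).div_const 2
    refine HasDerivAt.congr_deriv h2 (Eq.symm ?_)
    have hq := Real.sq_sqrt hw.le
    have hq0 := Real.sqrt_pos.2 hw
    have e : √(1 - ((x - β) / r) ^ 2) = √((b - x) * (x - a)) / r := by
      rw [← Real.sqrt_sq hr.le, ← Real.sqrt_div hw.le, Real.sqrt_sq hr.le]
      congr 1
      rw [ha, hb]; field_simp; ring
    simp only [id, e]
    set q := √((b - x) * (x - a)) with hqd
    field_simp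
    rw [hq, ha, hb]
    ring

open Real in
theorem m0_aux (β γ r a b : ℝ) (hr : 0 < r) (ha : a = β - r) (hb : b = β + r) (ha0 : 0 ≤ a) (hγ : 0 ≤ γ)
    (hp : a * b = γ ^ 2) :
    (∫ x in a..b, √((b - x) * (x - a)) / x)  = π * (β - γ) := by
  have hab : a < b := by linarith
  have hcont : ContinuousOn (fun x => √((b - x) * (x - a)) + β * arcsin ((x - β) / r)
      - γ * arcsin ((β * x - γ ^ 2) / (r * x))) (Set.Icc a b) := by
    have hc := continuous_arcsin
    refine ContinuousOn.sub (by fun_prop) ?_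
    rcases hγ.eq_or_lt with h0 | h0
    · simp only [← h0, zero_mul]; fun_prop
    · have : 0 < a := by
        rcases ha0.eq_or_lt with h | h
        · rw [← h] at hp; nlinarith
        · exact h
      refine continuousOn_const.mul (hc.comp_continuousOn ?_)
      refine ContinuousOn.div (by fun_prop) (by fun_prop) ?_
      intro x hx
      have : 0 < x := this.trans_le hx.1
      positivity
  have hder : ∀ x ∈ Set.Ioo a b, HasDerivAt (fun x => √((b - x) * (x - a)) + β * arcsin ((x - β) / r)
      - γ * arcsin ((β * x - γ ^ 2) / (r * x))) (√((b - x) * (x - a)) / x) x := by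
    intro x hx
    have hx0 : 0 < x := lt_of_le_of_lt ha0 hx.1
    have hw : 0 < (b - x) * (x - a) := mul_pos (by linarith [hx.2]) (by linarith [hx.1])
    have h1 : HasDerivAt (fun x => (b - x) * (x - a)) (2 * (β - x)) x := by
      refine HasDerivAt.congr_deriv (((hasDerivAt_id x).const_sub b).mul ((hasDerivAt_id x).sub_const a)) (Eq.symm ?_)
      simp; linarith
    have hx1 : (x - β) / r < 1 := by rw [div_lt_one hr]; linarith [hx.2]
    have hx2 : -1 < (x - β) / r := by rw [lt_div_iff₀ hr]; linarith [hx.1]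
    have h3 := (hasDerivAt_arcsin hx2.ne' hx1.ne).comp x (((hasDerivAt_id x).sub_const β).div_const r)
    have hq := Real.sq_sqrt hw.le
    have hq0 := Real.sqrt_pos.2 hw
    have hw2 : (b - x) * (x - a) = 2 * β * x - x ^ 2 - γ ^ 2 := by rw [← hp, ha, hb]; ring
    have hr2 : r ^ 2 = β ^ 2 - γ ^ 2 := by rw [← hp, ha, hb]; ring
    have e : √(1 - ((x - β) / r) ^ 2) = √((b - x) * (x - a)) / r := by
      rw [← Real.sqrt_sq hr.le, ← Real.sqrt_div hw.le, Real.sqrt_sq hr.le]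
      congr 1
      rw [ha, hb]; field_simp; ring
    have h4 : HasDerivAt (fun x => γ * arcsin ((β * x - γ ^ 2) / (r * x))) (γ ^ 2 / (x * √((b - x) * (x - a)))) x := by
      rcases hγ.eq_or_lt with h0 | h0
      · simp only [← h0, zero_mul]; simpa using hasDerivAt_const x (0:ℝ)
      · have e1 : 1 - ((β * x - γ ^ 2) / (r * x)) ^ 2 = γ ^ 2 * ((b - x) * (x - a)) / (r * x) ^ 2 := by
          rw [hw2]; field_simp; rw [hr2]; ring
        have e1p : 0 < 1 - ((β * x - γ ^ 2) / (r * x)) ^ 2 := by rw [e1]; positivity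
        have e2 : √(1 - ((β * x - γ ^ 2) / (r * x)) ^ 2) = γ * √((b - x) * (x - a)) / (r * x) := by
          rw [e1, Real.sqrt_div (by positivity), Real.sqrt_mul (by positivity), Real.sqrt_sq h0.le, Real.sqrt_sq (by positivity)]
        have n1 : (β * x - γ ^ 2) / (r * x) ≠ 1 := by intro h; rw [h] at e1p; norm_num at e1p
        have n2 : (β * x - γ ^ 2) / (r * x) ≠ -1 := by intro h; rw [h] at e1p; norm_num at e1p
        have := ((hasDerivAt_arcsin n2 n1).comp x 
          ((((hasDerivAt_id x).const_mul β).sub_const (γ ^ 2)).div ((hasDerivAt_id x).const_mul r) (mul_pos hr hx0).ne')).const_mul γ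
        refine HasDerivAt.congr_deriv this (Eq.symm ?_)
        simp only [id, e2]
        field_simp
        ring
    have h2 := ((h1.sqrt hw.ne').add (h3.const_mul β)).sub h4
    refine HasDerivAt.congr_deriv h2 (Eq.symm ?_)
    simp only [id, e]
    set q := √((b - x) * (x - a)) with hqd
    field_simp
    rw [hq, hw2]
    ring
  have h := intervalIntegral.integral_eq_sub_of_hasDerivAt_of_le hab.le hcont hder ?_
  · rw [h]
    have e1 : (b - β) / r = 1 := by rw [hb]; field_simp; ring
    have e2 : (a - β) / r = -1 := by rw [ha]; field_simp; ring
    simp only [e1, e2]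
    rcases hγ.eq_or_lt with h0 | h0
    · simp [← h0]; ring
    · have ha1 : 0 < a := by
        rcases ha0.eq_or_lt with h | h
        · rw [← h] at hp; nlinarith
        · exact h
      have hb1 := ha1.trans hab
      have e3 : (β * b - γ ^ 2) / (r * b) = 1 := by 
        rw [div_eq_one_iff_eq (by positivity), ← hp]
        rw [ha]; ring
      have e4 : (β * a - γ ^ 2) / (r * a) = -1 := by 
        rw [div_eq_iff (by positivity), ← hp]
        rw [hb]; ring
      rw [e3, e4]
      simp
      ring
  · apply intervalIntegral.intervalIntegrable_deriv_of_nonneg (by rwa [Set.uIcc_of_le hab.le]) 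
    · rw [min_eq_left hab.le, max_eq_right hab.le]; exact hder
    · rw [min_eq_left hab.le, max_eq_right hab.le]
      intro x hx
      have hx0 : 0 < x := lt_of_le_of_lt ha0 hx.1
      positivity

theorem moment_eq (α : ℝ) (n : ℕ) :
    freePoissonMoment α n = ∫ x in ((Real.sqrt α - 1) ^ 2)..((Real.sqrt α + 1) ^ 2),
      Real.sqrt (4 * x - (x - (α - 1)) ^ 2) / (2 * Real.pi * x) * x ^ n := by
  have hle : (Real.sqrt α - 1) ^ 2 ≤ (Real.sqrt α + 1) ^ 2 := by
    nlinarith [Real.sqrt_nonneg α]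
  have hm : Measurable (freePoissonDensity α) := by
    unfold freePoissonDensity
    exact Measurable.indicator (by fun_prop) measurableSet_Icc
  have hnn : ∀ x, 0 ≤ freePoissonDensity α x := by
    intro x
    apply Set.indicator_nonneg
    intro y hy
    have : 0 ≤ y := (sq_nonneg _).trans hy.1
    positivity
  unfold freePoissonMoment freePoissonLaw
  rw [integral_withDensity_eq_integral_toReal_smul (by fun_prop) (by simp),
    intervalIntegral.integral_of_le hle, ← integral_Icc_eq_integral_Ioc,
    ← integral_indicator measurableSet_Icc]
  congr 1
  ext x
  rw [ENNReal.toReal_ofReal (hnn x)]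
  unfold freePoissonDensity
  by_cases hx : x ∈ (Set.Icc ((Real.sqrt α - 1) ^ 2) ((Real.sqrt α + 1) ^ 2))
  · simp [Set.indicator_of_mem hx]
  · simp [Set.indicator_of_notMem hx]

/-- For every real `α ≥ 1`, the moments `m_n = ∫ xⁿ dμ_α(x)` satisfy `m_0 = 1` and
`m_n = (α − 1) m_{n−1} + Σ_{k=0}^{n−1} m_k m_{n−1−k}` for all `n ≥ 1`. -/
theorem stmt12 (α : ℝ) (hα : 1 ≤ α) :
    freePoissonMoment α 0 = 1 ∧
    ∀ n : ℕ, 1 ≤ n →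
      freePoissonMoment α n =
        (α - 1) * freePoissonMoment α (n - 1) +
          ∑ k ∈ Finset.range n, freePoissonMoment α k * freePoissonMoment α (n - 1 - k) := by
  set s := Real.sqrt α with hs
  have hss : s ^ 2 = α := Real.sq_sqrt (by linarith)
  have hs0 : 0 < s := Real.sqrt_pos.2 (by linarith)
  have hpi := Real.pi_pos
  set a := (s - 1) ^ 2 with ha
  set b := (s + 1) ^ 2 with hb
  have hab : a < b := by rw [ha, hb]; nlinarith
  have ha0 : 0 ≤ a := sq_nonneg _
  have hw : ∀ x, 4 * x - (x - (α - 1)) ^ 2 = (b - x) * (x - a) := by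
    intro x; rw [ha, hb, ← hss]; ring
  have hp : a * b = (α - 1) ^ 2 := by rw [ha, hb, ← hss]; ring
  have ha' : a = (α + 1) - 2 * s := by rw [ha, ← hss]; ring
  have hb' : b = (α + 1) + 2 * s := by rw [hb, ← hss]; ring
  have hm0 : freePoissonMoment α 0 = 1 := by
    rw [moment_eq]
    have := m0_aux (α + 1) (α - 1) (2 * s) a b (by linarith) ha' hb' ha0 (by linarith) hp
    simp only [hw, pow_zero, mul_one]
    have e : ∀ x : ℝ, √((b - x) * (x - a)) / (2 * Real.pi * x) = (1 / (2 * Real.pi)) * (√((b - x) * (x - a)) / x) := by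
      intro x; rw [div_mul_div_comm, one_mul]
    simp only [e]
    rw [intervalIntegral.integral_const_mul, this]
    field_simp
    ring
  have hmS : ∀ n, freePoissonMoment α (n + 1) =
      (1 / (2 * Real.pi)) * ∫ x in a..b, √((b - x) * (x - a)) * x ^ n := by
    intro n
    rw [moment_eq, ← intervalIntegral.integral_const_mul]
    congr 1
    ext x
    rw [← hw]
    rcases eq_or_ne x 0 with h | h
    · have : √(4 * x - (x - (α - 1)) ^ 2) = 0 := by
        apply Real.sqrt_eq_zero_of_nonpos
        rw [h]; nlinarith [sq_nonneg (0 - (α - 1))]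
      rw [this]; simp
    · field_simp; try ring
  have hm1 : freePoissonMoment α 1 = (α - 1) + 1 := by
    have := m1_aux (α + 1) (2 * s) a b (by linarith) ha' hb'
    rw [hmS 0]
    simp only [pow_zero, mul_one]
    rw [this, mul_pow, hss]
    field_simp
    ring
  have hrec : ∀ k : ℕ, ((k:ℝ) + 3) * freePoissonMoment α (k + 2) =
      (2 * k + 3) * (α + 1) * freePoissonMoment α (k + 1) - k * (α - 1) ^ 2 * freePoissonMoment α k := by
    intro k
    have := ibp_aux (α + 1) (α - 1) a b ha0 hab (by rw [ha', hb']; ring) hp k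
    rw [hmS (k + 1), hmS k]
    rcases k with _ | k
    · simp only [Nat.cast_zero, zero_mul] at this ⊢
      linear_combination (1 / (2 * Real.pi)) * this
    · rw [hmS k]
      rw [Nat.add_sub_cancel] at this
      linear_combination (1 / (2 * Real.pi)) * this
  refine ⟨hm0, fun n hn => ?_⟩
  obtain ⟨n, rfl⟩ : ∃ k, n = k + 1 := ⟨n - 1, by omega⟩
  have := ps_aux (α + 1) (α - 1) (by ring) (by ring) (freePoissonMoment α) hm0 hm1 hrec n
  simpa using this
end
end

section
/- For every real α ≥ 1 and every real z with 0 < z < ((√α + 1)²)⁻¹, the moment generating series of μ_α converges and Σ_{n=0}^∞ m_n zⁿ = ( 1 − (α − 1)z − √((1 − (α − 1)z)² − 4z) ) / (2z), where m_n = ∫ xⁿ dμ_α(x) and the square root is the nonnegative real square root (note (1 − (α−1)z)² − 4z > 0 for such z). -/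
open MeasureTheory

noncomputable section

/-- The antiderivative of `√(1-t²)/(k-t)`. -/
def fpF (k t : ℝ) : ℝ :=
  k * Real.arcsin t - Real.sqrt (1 - t ^ 2)
    - Real.sqrt (k ^ 2 - 1) * Real.arcsin ((k * t - 1) / (k - t))

lemma fpF_hasDerivAt {k t : ℝ} (hk : 1 ≤ k) (h1 : -1 < t) (h2 : t < 1) :
    HasDerivAt (fpF k) (Real.sqrt (1 - t ^ 2) / (k - t)) t := by
  have hpos : 0 < 1 - t ^ 2 := by nlinarith
  have hkt : 0 < k - t := by linarith
  have hs : 0 < Real.sqrt (1 - t ^ 2) := Real.sqrt_pos.mpr hpos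
  have hs2 : Real.sqrt (1 - t ^ 2) ^ 2 = 1 - t ^ 2 := Real.sq_sqrt hpos.le
  have hA : HasDerivAt (fun t : ℝ => k * Real.arcsin t) (k * (1 / Real.sqrt (1 - t ^ 2))) t :=
    (Real.hasDerivAt_arcsin (by linarith) (by linarith)).const_mul k
  have hB : HasDerivAt (fun t : ℝ => Real.sqrt (1 - t ^ 2))
      ((-(2 * t)) / (2 * Real.sqrt (1 - t ^ 2))) t := by
    have h : HasDerivAt (fun t : ℝ => 1 - t ^ 2) (-(2 * t)) t := by
      simpa using (hasDerivAt_pow 2 t).const_sub 1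
    exact h.sqrt hpos.ne'
  have hC : HasDerivAt (fun t : ℝ =>
      Real.sqrt (k ^ 2 - 1) * Real.arcsin ((k * t - 1) / (k - t)))
      ((k ^ 2 - 1) / ((k - t) * Real.sqrt (1 - t ^ 2))) t := by
    rcases hk.eq_or_lt with rfl | hk'
    · simpa using hasDerivAt_const t (0 : ℝ)
    · have hkk : 0 < k ^ 2 - 1 := by nlinarith
      have hu : 0 < Real.sqrt (k ^ 2 - 1) := Real.sqrt_pos.mpr hkk
      have hu2 : Real.sqrt (k ^ 2 - 1) ^ 2 = k ^ 2 - 1 := Real.sq_sqrt hkk.le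
      have hq : HasDerivAt (fun t : ℝ => (k * t - 1) / (k - t)) ((k ^ 2 - 1) / (k - t) ^ 2) t := by
        have hn : HasDerivAt (fun t : ℝ => k * t - 1) k t := by
          simpa using ((hasDerivAt_id t).const_mul k).sub_const 1
        have hd : HasDerivAt (fun t : ℝ => k - t) (-1) t := by
          simpa using (hasDerivAt_id t).const_sub k
        refine (hn.div hd hkt.ne').congr_deriv ?_
        ring
      have hval : Real.sqrt (1 - ((k * t - 1) / (k - t)) ^ 2)
          = Real.sqrt (k ^ 2 - 1) * Real.sqrt (1 - t ^ 2) / (k - t) := by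
        rw [show 1 - ((k * t - 1) / (k - t)) ^ 2
          = (Real.sqrt (k ^ 2 - 1) * Real.sqrt (1 - t ^ 2) / (k - t)) ^ 2 by
            rw [div_pow (_ * _), mul_pow, hu2, hs2]; field_simp; ring]
        exact Real.sqrt_sq (by positivity)
      have hlo : (k * t - 1) / (k - t) ≠ -1 := by
        intro h
        rw [div_eq_iff hkt.ne'] at h
        nlinarith
      have hhi : (k * t - 1) / (k - t) ≠ 1 := by
        intro h
        rw [div_eq_iff hkt.ne'] at h
        nlinarith
      have := ((Real.hasDerivAt_arcsin hlo hhi).comp t hq).const_mul (Real.sqrt (k ^ 2 - 1))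
      refine this.congr_deriv ?_
      rw [hval]
      field_simp
  have := (hA.sub hB).sub hC
  refine this.congr_deriv ?_
  field_simp
  rw [hs2]
  ring

lemma fpF_cont {k : ℝ} (hk : 1 ≤ k) : ContinuousOn (fpF k) (Set.Icc (-1) 1) := by
  unfold fpF
  refine ContinuousOn.sub (by fun_prop) ?_
  rcases hk.eq_or_lt with rfl | hk'
  · simpa using continuousOn_const
  · refine ContinuousOn.mul continuousOn_const ?_
    refine Real.continuous_arcsin.comp_continuousOn ?_
    refine ContinuousOn.div (by fun_prop) (by fun_prop) ?_
    intro t ht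
    have := ht.2
    linarith

lemma fpF_diff {k : ℝ} (hk : 1 ≤ k) :
    fpF k 1 - fpF k (-1) = Real.pi * (k - Real.sqrt (k ^ 2 - 1)) := by
  rcases hk.eq_or_lt with rfl | hk'
  · simp [fpF]
  · have h1 : (k * 1 - 1) / (k - 1) = 1 := by
      rw [mul_one]; exact div_self (by linarith)
    have h2 : (k * (-1) - 1) / (k - (-1)) = -1 := by
      rw [div_eq_iff (by linarith)]; ring
    unfold fpF
    rw [h1, h2]
    simp
    ring

lemma fp_int_right {m r c : ℝ} (hr : 0 < r) (hc : m + r ≤ c) :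
    IntervalIntegrable (fun x => Real.sqrt (r ^ 2 - (x - m) ^ 2) / (c - x)) volume (m - r) (m + r)
    ∧ ∫ x in (m - r)..(m + r), Real.sqrt (r ^ 2 - (x - m) ^ 2) / (c - x)
      = Real.pi * ((c - m) - Real.sqrt ((c - m) ^ 2 - r ^ 2)) := by
  set k := (c - m) / r with hk
  have hk1 : 1 ≤ k := by rw [hk, le_div_iff₀ hr]; linarith
  have hle : m - r ≤ m + r := by linarith
  have hcont : ContinuousOn (fun x => r * fpF k ((x - m) / r)) (Set.Icc (m - r) (m + r)) := by
    refine ContinuousOn.mul continuousOn_const ((fpF_cont hk1).comp (by fun_prop) ?_)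
    intro x hx
    constructor
    · rw [le_div_iff₀ hr]; linarith [hx.1]
    · rw [div_le_iff₀ hr]; linarith [hx.2]
  have hder : ∀ x ∈ Set.Ioo (m - r) (m + r), HasDerivAt (fun x => r * fpF k ((x - m) / r))
      (Real.sqrt (r ^ 2 - (x - m) ^ 2) / (c - x)) x := by
    intro x hx
    have h1 : -1 < (x - m) / r := by rw [lt_div_iff₀ hr]; linarith [hx.1]
    have h2 : (x - m) / r < 1 := by rw [div_lt_iff₀ hr]; linarith [hx.2]
    have hin : HasDerivAt (fun x : ℝ => (x - m) / r) (1 / r) x :=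
      ((hasDerivAt_id x).sub_const m).div_const r
    have := ((fpF_hasDerivAt hk1 h1 h2).comp x hin).const_mul r
    refine this.congr_deriv ?_
    have hs : Real.sqrt (r ^ 2 - (x - m) ^ 2) = r * Real.sqrt (1 - ((x - m) / r) ^ 2) := by
      rw [show r ^ 2 - (x - m) ^ 2 = r ^ 2 * (1 - ((x - m) / r) ^ 2) by field_simp,
        Real.sqrt_mul (by positivity), Real.sqrt_sq hr.le]
    have hcx : c - x ≠ 0 := by have := hx.2; linarith
    have hkx : k - (x - m) / r = (c - x) / r := by rw [hk]; field_simp; ring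
    rw [hs, hkx]
    field_simp
  have hint : IntervalIntegrable (fun x => Real.sqrt (r ^ 2 - (x - m) ^ 2) / (c - x)) volume
      (m - r) (m + r) := by
    refine intervalIntegral.intervalIntegrable_deriv_of_nonneg
      (g := fun x => r * fpF k ((x - m) / r)) ?_ ?_ ?_
    · rwa [Set.uIcc_of_le hle]
    · rwa [min_eq_left hle, max_eq_right hle]
    · rw [min_eq_left hle, max_eq_right hle]
      intro x hx
      have := hx.2
      exact div_nonneg (Real.sqrt_nonneg _) (by linarith)
  refine ⟨hint, ?_⟩
  rw [intervalIntegral.integral_eq_sub_of_hasDerivAt_of_le hle hcont hder hint]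
  have e1 : (m + r - m) / r = 1 := by field_simp; ring
  have e2 : (m - r - m) / r = -1 := by field_simp; ring
  rw [e1, e2, ← mul_sub, fpF_diff hk1]
  have hs : Real.sqrt ((c - m) ^ 2 - r ^ 2) = r * Real.sqrt (k ^ 2 - 1) := by
    rw [show (c - m) ^ 2 - r ^ 2 = r ^ 2 * (k ^ 2 - 1) by rw [hk]; field_simp,
      Real.sqrt_mul (by positivity), Real.sqrt_sq hr.le]
  have hkr : c - m = r * k := by rw [hk]; field_simp
  rw [hs, hkr]
  ring

lemma fp_int_left {m r : ℝ} (hr : 0 < r) (hc : r ≤ m) :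
    IntervalIntegrable (fun x => Real.sqrt (r ^ 2 - (x - m) ^ 2) / x) volume (m - r) (m + r)
    ∧ ∫ x in (m - r)..(m + r), Real.sqrt (r ^ 2 - (x - m) ^ 2) / x
      = Real.pi * (m - Real.sqrt (m ^ 2 - r ^ 2)) := by
  obtain ⟨h1, h2⟩ := fp_int_right (m := m) (c := 2 * m) hr (by linarith)
  have e : (fun x => Real.sqrt (r ^ 2 - (x - m) ^ 2) / x)
      = fun x => (fun y => Real.sqrt (r ^ 2 - (y - m) ^ 2) / (2 * m - y)) (2 * m - x) := by
    funext x
    simp only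
    congr 2
    · ring
    · ring
  have e1 : 2 * m - (m - r) = m + r := by ring
  have e2 : 2 * m - (m + r) = m - r := by ring
  constructor
  · rw [e]
    have := (h1.comp_sub_left (2 * m)).symm
    rwa [e1, e2] at this
  · rw [e, intervalIntegral.integral_comp_sub_left
      (fun y => Real.sqrt (r ^ 2 - (y - m) ^ 2) / (2 * m - y)), e1, e2, h2]
    ring_nf

/-- For every real `α ≥ 1` and `0 < z < ((√α + 1)²)⁻¹`, the moment generating series of
`μ_α` converges, with sum `(1 − (α−1)z − √((1 − (α−1)z)² − 4z)) / (2z)`. -/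
theorem stmt14 (α : ℝ) (hα : 1 ≤ α) (z : ℝ) (hz0 : 0 < z)
    (hz : z < ((Real.sqrt α + 1) ^ 2)⁻¹) :
    (Summable fun n : ℕ => freePoissonMoment α n * z ^ n) ∧
    ∑' n : ℕ, freePoissonMoment α n * z ^ n =
      (1 - (α - 1) * z - Real.sqrt ((1 - (α - 1) * z) ^ 2 - 4 * z)) / (2 * z) := by
  have hs1 : 1 ≤ Real.sqrt α := Real.one_le_sqrt.mpr hα
  have hs2 : Real.sqrt α ^ 2 = α := Real.sq_sqrt (by linarith)
  set s := Real.sqrt α with hs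
  set m : ℝ := 1 + α with hm
  set r : ℝ := 2 * s with hr
  have hr0 : 0 < r := by linarith
  have hrm : r ≤ m := by nlinarith [sq_nonneg (s - 1)]
  have ha : (s - 1) ^ 2 = m - r := by rw [hm, hr, ← hs2]; ring
  have hb : (s + 1) ^ 2 = m + r := by rw [hm, hr, ← hs2]; ring
  have hle : m - r ≤ m + r := by linarith
  have hb0 : 0 < m + r := by linarith
  have hq : z * (m + r) < 1 := by
    rw [hb, lt_inv_comm₀ hz0 hb0] at hz
    calc z * (m + r) < z * z⁻¹ := by gcongr
      _ = 1 := mul_inv_cancel₀ hz0.ne'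
  have hc : m + r ≤ 1 / z := by rw [le_div_iff₀ hz0]; linarith
  obtain ⟨iL, vL⟩ := fp_int_left hr0 hrm
  obtain ⟨iR, vR⟩ := fp_int_right hr0 hc
  set f := freePoissonDensity α with hf
  have hfdef : f = (Set.Icc (m - r) (m + r)).indicator
      fun x => (1 / (2 * Real.pi)) * (Real.sqrt (r ^ 2 - (x - m) ^ 2) / x) := by
    rw [hf]
    unfold freePoissonDensity
    rw [← hs, ha, hb]
    congr 1
    funext x
    rw [show 4 * x - (x - (α - 1)) ^ 2 = r ^ 2 - (x - m) ^ 2 by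
      rw [hr, hm, mul_pow, hs2]; ring]
    rw [div_mul_div_comm, one_mul]
  have hf0 : ∀ x, 0 ≤ f x := by
    intro x
    rw [hfdef]
    refine Set.indicator_nonneg ?_ x
    intro y hy
    have : 0 ≤ y := by linarith [hy.1]
    positivity
  have hfm : Measurable f := by
    rw [hfdef]
    refine Measurable.indicator ?_ measurableSet_Icc
    fun_prop
  have hfi : Integrable f := by
    rw [hfdef, integrable_indicator_iff measurableSet_Icc]
    refine Integrable.const_mul ?_ _
    exact (intervalIntegrable_iff_integrableOn_Icc_of_le hle).mp iL
  have hmom : ∀ n, freePoissonMoment α n * z ^ n = ∫ x, (z * x) ^ n * f x := by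
    intro n
    unfold freePoissonMoment freePoissonLaw
    rw [integral_withDensity_eq_integral_toReal_smul hfm.ennreal_ofReal (by simp), ← integral_mul_const]
    congr 1
    funext x
    rw [ENNReal.toReal_ofReal (hf0 x), smul_eq_mul, mul_pow]
    ring
  have hbd : ∀ n x, ‖(z * x) ^ n * f x‖ ≤ (z * (m + r)) ^ n * f x := by
    intro n x
    by_cases hx : x ∈ Set.Icc (m - r) (m + r)
    · have h0 : 0 ≤ x := by linarith [hx.1]
      rw [Real.norm_of_nonneg (mul_nonneg (by positivity) (hf0 x))]
      have := hf0 x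
      have := hx.2
      gcongr
    · have : f x = 0 := by rw [hfdef]; exact Set.indicator_of_notMem hx _
      simp [this]
  have hFi : ∀ n : ℕ, Integrable (fun x => (z * x) ^ n * f x) := by
    intro n
    refine Integrable.mono' (hfi.const_mul ((z * (m + r)) ^ n)) (by fun_prop) ?_
    exact Filter.Eventually.of_forall (hbd n)
  have hq0 : 0 ≤ z * (m + r) := by positivity
  have hsum : Summable fun n : ℕ => ∫ x, ‖(z * x) ^ n * f x‖ := by
    refine Summable.of_nonneg_of_le (fun n => integral_nonneg fun x => norm_nonneg _) (fun n => ?_)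
      ((summable_geometric_of_lt_one hq0 hq).mul_right (∫ x, f x))
    rw [← integral_const_mul]
    exact integral_mono (hFi n).norm (hfi.const_mul _) (hbd n)
  have hmain := hasSum_integral_of_summable_integral_norm hFi hsum
  have hval : ∫ x, ∑' n : ℕ, (z * x) ^ n * f x
      = (1 - (α - 1) * z - Real.sqrt ((1 - (α - 1) * z) ^ 2 - 4 * z)) / (2 * z) := by
    have hpt : ∀ x, x ≠ 0 → ∑' n : ℕ, (z * x) ^ n * f x = (Set.Icc (m - r) (m + r)).indicator
        (fun x => (1 / (2 * Real.pi)) * (Real.sqrt (r ^ 2 - (x - m) ^ 2) / x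
          + Real.sqrt (r ^ 2 - (x - m) ^ 2) / (1 / z - x))) x := by
      intro x hx0
      by_cases hx : x ∈ Set.Icc (m - r) (m + r)
      · have h0 : 0 ≤ x := by linarith [hx.1]
        have h1 : z * x < 1 := lt_of_le_of_lt (by have := hx.2; gcongr) hq
        rw [tsum_mul_right, tsum_geometric_of_lt_one (by positivity) h1, hfdef,
          Set.indicator_of_mem hx, Set.indicator_of_mem hx]
        have h2 : 1 - z * x ≠ 0 := by linarith
        have h3 : 1 / z - x = (1 - z * x) / z := by field_simp
        rw [h3]
        field_simp
        ring
      · have : f x = 0 := by rw [hfdef]; exact Set.indicator_of_notMem hx _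
        rw [Set.indicator_of_notMem hx]
        simp [this]
    have hae : (fun x => ∑' n : ℕ, (z * x) ^ n * f x) =ᵐ[volume]
        (Set.Icc (m - r) (m + r)).indicator
        (fun x => (1 / (2 * Real.pi)) * (Real.sqrt (r ^ 2 - (x - m) ^ 2) / x
          + Real.sqrt (r ^ 2 - (x - m) ^ 2) / (1 / z - x))) := by
      filter_upwards [Measure.ae_ne volume (0 : ℝ)] with x hx using hpt x hx
    rw [integral_congr_ae hae, integral_indicator measurableSet_Icc, integral_Icc_eq_integral_Ioc,
      ← intervalIntegral.integral_of_le hle, intervalIntegral.integral_const_mul,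
      intervalIntegral.integral_add iL iR, vL, vR]
    have w1 : Real.sqrt (m ^ 2 - r ^ 2) = α - 1 := by
      rw [show m ^ 2 - r ^ 2 = (α - 1) ^ 2 by rw [hr, hm, mul_pow, hs2]; ring]
      exact Real.sqrt_sq (by linarith)
    have w2 : Real.sqrt ((1 / z - m) ^ 2 - r ^ 2)
        = Real.sqrt ((1 - (α - 1) * z) ^ 2 - 4 * z) / z := by
      rw [show (1 / z - m) ^ 2 - r ^ 2 = ((1 - (α - 1) * z) ^ 2 - 4 * z) / z ^ 2 by
        rw [hr, hm, mul_pow, hs2]; field_simp; ring]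
      rw [Real.sqrt_div' _ (by positivity), Real.sqrt_sq hz0.le]
    rw [w1, w2, hm]
    have := Real.pi_ne_zero
    field_simp
    ring
  rw [hval] at hmain
  simp_rw [hmom]
  exact ⟨hmain.summable, hmain.tsum_eq⟩
end
end
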